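/- Let C be a nonsingular plane cubic over F_4 with exactly 9 F_4-points, and with μ_δ denoting the number of F_4-lines meeting C(F_4) in exactly δ points. Then either (μ₀, μ₁, μ₂, μ₃) = (0, 9, 0, 12) or (μ₀, μ₁, μ₂, μ₃) = (3, 0, 9, 9). -/

import Mathlib

open MvPolynomial

/-- The number of `F₄`-lines meeting the rational points of the curve `f = 0` in exactly `δ`
points. Lines of `P²(F₄)` are parametrized by points `L` of the dual projective plane, the
line being `{P : L₀P₀ + L₁P₁ + L₂P₂ = 0}`. -/
noncomputable def mu (f : MvPolynomial (Fin 3) (GaloisField 2 2)) (δ : ℕ) : ℕ :=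
  {L : Projectivization (GaloisField 2 2) (Fin 3 → GaloisField 2 2) |
    ({P : Projectivization (GaloisField 2 2) (Fin 3 → GaloisField 2 2) |
      L.rep 0 * P.rep 0 + L.rep 1 * P.rep 1 + L.rep 2 * P.rep 2 = 0 ∧
      eval P.rep f = 0}).ncard = δ}.ncard

/-- The curve `f = 0` is nonsingular (smooth over an algebraic closure). -/
def IsNonsingularCubic (f : MvPolynomial (Fin 3) (GaloisField 2 2)) : Prop :=
  ∀ v : Fin 3 → AlgebraicClosure (GaloisField 2 2), v ≠ 0 →
    eval v (MvPolynomial.map (algebraMap (GaloisField 2 2) (AlgebraicClosure (GaloisField 2 2))) f) = 0 →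
    ∃ i, eval v (pderiv i (MvPolynomial.map
      (algebraMap (GaloisField 2 2) (AlgebraicClosure (GaloisField 2 2))) f)) ≠ 0


section Plane

open Configuration Finset
open scoped Classical

/-- The number of points of `S` on the line `l`. -/
noncomputable def secantCard {P L : Type*} [Membership P L] (S : Finset P) (l : L) : ℕ :=
  #{q ∈ S | q ∈ l}

lemma sum_secantCard_mul {P L : Type*} [Membership P L] [Fintype L] (S : Finset P) (g : L → ℕ) :
    ∑ l : L, secantCard S l * g l = ∑ p ∈ S, ∑ l : L with p ∈ l, g l := by
  simp_rw [secantCard, card_filter, sum_mul, ite_mul, one_mul, zero_mul, sum_filter]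
  exact sum_comm

variable {P L : Type*} [Membership P L] [Fintype P] [Fintype L] [ProjectivePlane P L]

lemma card_lines_through (p : P) : #{l : L | p ∈ l} = ProjectivePlane.order P L + 1 := by
  rw [← Fintype.card_subtype, ← Nat.card_eq_fintype_card, ← lineCount,
    ProjectivePlane.lineCount_eq]

lemma card_lines_through_pair (p q : P) : #{l : L | p ∈ l ∧ q ∈ l} =
    1 + if p = q then ProjectivePlane.order P L else 0 := by
  split_ifs with h
  · simp [← h, card_lines_through, add_comm]
  · obtain ⟨l, hl, huniq⟩ := HasLines.existsUnique_line P L p q h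
    rw [card_eq_one.2 ⟨l, ?_⟩]
    ext m
    simp only [mem_filter, mem_univ, true_and, mem_singleton]
    exact ⟨huniq m, fun h ↦ h ▸ hl⟩

variable (L) in
lemma sum_secantCard_lines_through (S : Finset P) (p : P) :
    ∑ l : L with p ∈ l, secantCard S l =
      #S + if p ∈ S then ProjectivePlane.order P L else 0 := by
  calc
    _ = ∑ q ∈ S, #{l : L | p ∈ l ∧ q ∈ l} := by
      simp_rw [secantCard, card_filter, ite_and]
      rw [sum_comm]
      simp_rw [sum_filter]
    _ = _ := by simp_rw [card_lines_through_pair, sum_add_distrib, sum_ite_eq, card_eq_sum_ones]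

/-- The other three lines through a point on two lines missing `S` are 3-lines. -/
lemma secantCard_eq_three_of_mem (hP : ProjectivePlane.order P L = 4) {S : Finset P}
    (hS : #S = 9) (h3 : ∀ l : L, secantCard S l ≤ 3) {p : P} {l m k : L} (hlm : l ≠ m)
    (hpl : p ∈ l) (hpm : p ∈ m) (hl : secantCard S l = 0) (hm : secantCard S m = 0)
    (hpk : p ∈ k) (hkl : k ≠ l) (hkm : k ≠ m) : secantCard S k = 3 := by
  set T : Finset L := {n : L | p ∈ n} with hT
  have hc : #T = 5 := by rw [hT, card_lines_through, hP]
  have hsum : 9 ≤ ∑ n ∈ T, secantCard S n := by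
    rw [sum_secantCard_lines_through, hS]; omega
  have hsub : {k, l, m} ⊆ T := by
    intro n; simp only [mem_insert, mem_singleton, hT, mem_filter, mem_univ, true_and]
    rintro (rfl | rfl | rfl) <;> assumption
  have hc3 : #({k, l, m} : Finset L) = 3 := card_eq_three.2 ⟨k, l, m, hkl, hkm, hlm, rfl⟩
  rw [← sum_sdiff hsub, sum_insert (by simp [hkl, hkm]), sum_pair hlm, hl, hm] at hsum
  have := sum_le_card_nsmul (T \ {k, l, m}) (fun n ↦ secantCard S n) 3 fun n _ ↦ h3 n
  rw [card_sdiff_of_subset hsub, hc, hc3, smul_eq_mul] at this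
  have := h3 k
  omega

lemma line_counts (hP : ProjectivePlane.order P L = 4) {S : Finset P}
    (hS : #S = 9) (h3 : ∀ l : L, secantCard S l ≤ 3) :
    #{l : L | secantCard S l = 1} + 3 * #{l : L | secantCard S l = 0} = 9 ∧
      #{l : L | secantCard S l = 2} = 3 * #{l : L | secantCard S l = 0} ∧
      #{l : L | secantCard S l = 3} + #{l : L | secantCard S l = 0} = 12 := by
  have key (g : ℕ → ℕ) : ∑ l : L, g (secantCard S l) =
      ∑ i ∈ range 4, #{l : L | secantCard S l = i} * g i := by
    rw [← sum_fiberwise_of_maps_to (g := secantCard S) (t := range 4)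
      fun l _ ↦ mem_range.2 (Nat.lt_succ_of_le (h3 l))]
    refine sum_congr rfl fun i _ ↦ ?_
    rw [sum_congr rfl fun l hl ↦ by rw [(mem_filter.1 hl).2], sum_const, smul_eq_mul]
  have e0 := key fun _ ↦ 1
  have e1 := key fun i ↦ i * 1
  have e2 := key fun i ↦ i * i
  rw [sum_secantCard_mul S fun _ ↦ 1] at e1
  rw [sum_secantCard_mul S fun l ↦ secantCard S l, sum_congr rfl fun p hp ↦ by
    rw [sum_secantCard_lines_through, if_pos hp]] at e2
  simp only [card_lines_through, sum_const, card_univ, smul_eq_mul, mul_one,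
    ProjectivePlane.card_lines P L, hP, hS, sum_range_succ, range_zero, sum_empty] at e0 e1 e2
  omega

lemma card_external_ne_one (hP : ProjectivePlane.order P L = 4) {S : Finset P}
    (hS : #S = 9) (h3 : ∀ l : L, secantCard S l ≤ 3) :
    #{l : L | secantCard S l = 0} ≠ 1 := by
  intro h1
  have h6 : #{l : L | secantCard S l = 1} = 6 := by
    have := line_counts hP hS h3
    omega
  obtain ⟨l, hl⟩ := card_eq_one.1 h1
  have hl' (m : L) : secantCard S m = 0 ↔ m = l := by
    simpa using congrArg (m ∈ ·) hl
  have hl0 := (hl' l).2 rfl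
  have hpts : #{p : P | p ∈ l} = 5 := by
    rw [← Fintype.card_subtype, ← Nat.card_eq_fintype_card, ← pointCount,
      ProjectivePlane.pointCount_eq, hP]
  -- two 1-lines meet at a point of `l` by the pigeonhole principle
  have hmeet (m : L) : ∃ p, p ∈ l ∧ p ∈ m := by
    obtain rfl | h := eq_or_ne m l
    · have : #{p : P | p ∈ m} ≠ 0 := by omega
      obtain ⟨p, hp⟩ := card_ne_zero.1 this
      exact ⟨p, by simpa using hp⟩
    · obtain ⟨p, hp, -⟩ := HasPoints.existsUnique_point P L l m h.symm
      exact ⟨p, hp⟩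
  choose f hfl hfm using hmeet
  obtain ⟨m, hm, n, hn, hmn, hf⟩ := exists_ne_map_eq_of_card_lt_of_maps_to
    (s := ({m : L | secantCard S m = 1} : Finset L)) (t := ({p : P | p ∈ l} : Finset P))
    (f := f) (by omega) (fun m _ ↦ by simpa using hfl m)
  simp only [mem_filter, mem_univ, true_and] at hm hn
  have hml : m ≠ l := fun h ↦ by rw [h] at hm; omega
  have hnl : n ≠ l := fun h ↦ by rw [h] at hn; omega
  set T : Finset L := {k : L | f m ∈ k} with hT
  have hc : #T = 5 := by rw [hT, card_lines_through, hP]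
  have hsum : 9 ≤ ∑ n ∈ T, secantCard S n := by
    rw [sum_secantCard_lines_through, hS]; omega
  have hsub : {m, n, l} ⊆ T := by
    intro k; simp only [mem_insert, mem_singleton, hT, mem_filter, mem_univ, true_and]
    rintro (rfl | rfl | rfl)
    exacts [hfm _, hf ▸ hfm _, hfl _]
  have hc3 : #({m, n, l} : Finset L) = 3 := card_eq_three.2 ⟨m, n, l, hmn, hml, hnl, rfl⟩
  rw [← sum_sdiff hsub, sum_insert (by simp [hmn, hml]), sum_pair hnl, hl0, hm, hn] at hsum
  have := sum_le_card_nsmul (T \ {m, n, l}) (fun n ↦ secantCard S n) 3 fun n _ ↦ h3 n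
  rw [card_sdiff_of_subset hsub, hc, hc3, smul_eq_mul] at this
  omega

lemma line_counts_of_exists_third (hP : ProjectivePlane.order P L = 4) {S : Finset P}
    (hS : #S = 9) (h3 : ∀ l : L, secantCard S l ≤ 3)
    (hthird : ∀ (p : P) (l m : L), l ≠ m → p ∈ l → p ∈ m → secantCard S l = 0 →
      secantCard S m = 0 → (∀ k : L, p ∈ k → k ≠ l → k ≠ m → secantCard S k = 3) →
      ∃ n : L, p ∉ n ∧ secantCard S n = 0) :
    (#{l : L | secantCard S l = 0} = 0 ∧ #{l : L | secantCard S l = 1} = 9 ∧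
      #{l : L | secantCard S l = 2} = 0 ∧ #{l : L | secantCard S l = 3} = 12) ∨
    (#{l : L | secantCard S l = 0} = 3 ∧ #{l : L | secantCard S l = 1} = 0 ∧
      #{l : L | secantCard S l = 2} = 9 ∧ #{l : L | secantCard S l = 3} = 9) := by
  have hcount := line_counts hP hS h3
  have hne := card_external_ne_one hP hS h3
  suffices 2 ≤ #{l : L | secantCard S l = 0} → 3 ≤ #{l : L | secantCard S l = 0} by omega
  intro h2
  obtain ⟨l, hl, m, hm, hlm⟩ := one_lt_card.1 h2
  obtain ⟨p, ⟨hpl, hpm⟩, -⟩ := HasPoints.existsUnique_point P L l m hlm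
  have hl0 := (mem_filter.1 hl).2
  have hm0 := (mem_filter.1 hm).2
  obtain ⟨n, hpn, hn⟩ := hthird p l m hlm hpl hpm hl0 hm0 fun k hk hkl hkm ↦
    secantCard_eq_three_of_mem hP hS h3 hlm hpl hpm hl0 hm0 hk hkl hkm
  exact two_lt_card.2 ⟨l, hl, m, hm, n, by simpa using hn, hlm, fun h ↦ hpn (h ▸ hpl),
    fun h ↦ hpn (h ▸ hpm)⟩

end Plane

section Algebra

open Matrix

/-- A cubic form is the diagonal of a trilinear form, which also computes its derivatives. -/
lemma MvPolynomial.IsHomogeneous.exists_trilinear {σ R : Type*} [Fintype σ] [CommRing R]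
    {f : MvPolynomial σ R} (hf : f.IsHomogeneous 3) :
    ∃ T : (σ → R) →ₗ[R] (σ → R) →ₗ[R] (σ → R) →ₗ[R] R, ∀ v, eval v f = T v v v ∧
      ∀ w, (fun i ↦ eval v (pderiv i f)) ⬝ᵥ w = T w v v + T v w v + T v v w := by
  classical
  rw [← mem_homogeneousSubmodule, homogeneousSubmodule_eq_finsupp_supported,
    AddMonoidAlgebra.supported_eq_span_single] at hf
  induction hf using Submodule.span_induction with
  | zero => exact ⟨0, by simp [dotProduct]⟩
  | add f g _ _ hf hg =>
    obtain ⟨T, hT⟩ := hf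
    obtain ⟨U, hU⟩ := hg
    refine ⟨T + U, fun v ↦ ⟨by simp [(hT v).1, (hU v).1], fun w ↦ ?_⟩⟩
    have h1 := (hT v).2 w
    have h2 := (hU v).2 w
    simp only [dotProduct, map_add, add_mul, Finset.sum_add_distrib, LinearMap.add_apply]
      at h1 h2 ⊢
    rw [h1, h2]
    ring
  | smul a f _ hf =>
    obtain ⟨T, hT⟩ := hf
    have haf : a • f = C a * f := smul_eq_C_mul f a
    simp only [haf]
    refine ⟨a • T, fun v ↦ ⟨by simp [(hT v).1], fun w ↦ ?_⟩⟩
    have h1 := (hT v).2 w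
    simp only [dotProduct, pderiv_C_mul, map_mul, eval_C, mul_assoc, ← Finset.mul_sum,
      LinearMap.smul_apply, smul_eq_mul] at h1 ⊢
    rw [h1]
    ring
  | mem f hf =>
    obtain ⟨d, hd, rfl⟩ := hf
    have hcard : (Finsupp.toMultiset d).card = 3 := by
      rw [Finsupp.card_toMultiset]; exact hd
    obtain ⟨i, j, k, hijk⟩ := Multiset.card_eq_three.1 hcard
    have hmon : (AddMonoidAlgebra.single d 1 : MvPolynomial σ R) = X i * X j * X k := by
      have hd' : d = Finsupp.single i 1 + Finsupp.single j 1 + Finsupp.single k 1 := by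
        apply Multiset.toFinsupp.symm.injective
        refine hijk.trans ?_
        simp [← Multiset.singleton_add, add_assoc]
      rw [hd', single_eq_monomial]
      simp [X, monomial_mul]
    simp only [hmon]
    refine ⟨(LinearMap.proj i : (σ → R) →ₗ[R] R).smulRight
      ((LinearMap.proj j : (σ → R) →ₗ[R] R).smulRight (LinearMap.proj k)), fun v ↦
        ⟨by simp [mul_assoc], fun w ↦ ?_⟩⟩
    simp only [dotProduct, Derivation.leibniz, pderiv_X, map_add, smul_eq_mul, map_mul, eval_X,
      add_mul, Finset.sum_add_distrib, LinearMap.smulRight_apply, LinearMap.smul_apply,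
      LinearMap.proj_apply]
    simp [Pi.single_apply, apply_ite (eval v), mul_add, add_mul, Finset.sum_add_distrib]
    ring

lemma exists_eq_smul_add_smul {F : Type*} [Field F] {p q u l : Fin 3 → F}
    (hpq : LinearIndependent F ![p, q]) (hl : l ≠ 0) (hp : p ⬝ᵥ l = 0) (hq : q ⬝ᵥ l = 0)
    (hu : u ⬝ᵥ l = 0) : ∃ a b : F, u = a • p + b • q := by
  have hdet : (of ![u, p, q]).det = 0 := exists_mulVec_eq_zero_iff.1 ⟨l, hl, by
    ext i; fin_cases i <;> simpa [mulVec]⟩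
  obtain ⟨c, hc, h⟩ := exists_vecMul_eq_zero_iff.2 hdet
  have h' : c 0 • u + c 1 • p + c 2 • q = 0 := by
    rw [← h]
    ext i
    simp [vecMul, dotProduct, Fin.sum_univ_three]
  have h0 : c 0 ≠ 0 := by
    intro h0
    rw [h0, zero_smul, zero_add] at h'
    obtain ⟨h1, h2⟩ := LinearIndependent.pair_iff.1 hpq _ _ h'
    exact hc (by ext i; fin_cases i <;> assumption)
  refine ⟨-(c 1 / c 0), -(c 2 / c 0), ?_⟩
  ext i
  have := congrFun h' i
  simp only [Pi.add_apply, Pi.smul_apply, smul_eq_mul, Pi.zero_apply] at this ⊢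
  field_simp
  linear_combination this

/-- Coordinates of a point of the line `pq` different from `p` and `q`, in general form. -/
lemma exists_coords {F : Type*} [Field F] {p q u l : Fin 3 → F}
    (hpq : LinearIndependent F ![p, q]) (hup : LinearIndependent F ![u, p])
    (huq : LinearIndependent F ![u, q]) (hl : l ≠ 0) (hp : p ⬝ᵥ l = 0) (hq : q ⬝ᵥ l = 0)
    (hu : u ⬝ᵥ l = 0) : ∃ a b : F, a ≠ 0 ∧ b ≠ 0 ∧ u = a • p + b • q := by
  obtain ⟨a, b, rfl⟩ := exists_eq_smul_add_smul hpq hl hp hq hu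
  refine ⟨a, b, ?_, ?_, rfl⟩
  · rintro rfl
    simpa using LinearIndependent.pair_iff.1 huq 1 (-b) (by simp)
  · rintro rfl
    simpa using LinearIndependent.pair_iff.1 hup 1 (-a) (by simp)

lemma mul_sub_mul_ne_zero {F V : Type*} [Field F] [AddCommGroup V] [Module F V] {p q : V}
    {a b c d : F} (ha : a ≠ 0)
    (h : LinearIndependent F ![a • p + b • q, c • p + d • q]) : a * d - b * c ≠ 0 := by
  intro h0
  have := LinearIndependent.pair_iff.1 h (-c) a (by
    have : -c • (a • p + b • q) + a • (c • p + d • q) = (a * d - b * c) • q := by module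
    rw [this, h0, zero_smul])
  exact ha this.2

variable {K : Type*} [Field K]

lemma trilinear_diag (T : (Fin 3 → K) →ₗ[K] (Fin 3 → K) →ₗ[K] (Fin 3 → K) →ₗ[K] K)
    (p q : Fin 3 → K) (a b : K) :
    T (a • p + b • q) (a • p + b • q) (a • p + b • q) =
      a ^ 3 * T p p p + a ^ 2 * b * (T q p p + T p q p + T p p q) +
      a * b ^ 2 * (T p q q + T q p q + T q q p) + b ^ 3 * T q q q := by
  simp only [map_add, map_smul, LinearMap.add_apply, LinearMap.smul_apply, smul_eq_mul]
  ring

/-- A cubic form with four zeros on a line is singular at some point of that line. -/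
lemma exists_singular_of_four_zeros [IsAlgClosed K] {f : MvPolynomial (Fin 3) K}
    (hf : f.IsHomogeneous 3) {p q : Fin 3 → K} {a b c d : K} (hpq : LinearIndependent K ![p, q])
    (ha : a ≠ 0) (hb : b ≠ 0) (hc : c ≠ 0) (hd : d ≠ 0) (hne : a * d - b * c ≠ 0)
    (hp : eval p f = 0) (hq : eval q f = 0) (hu : eval (a • p + b • q) f = 0)
    (hw : eval (c • p + d • q) f = 0) :
    ∃ v ≠ 0, eval v f = 0 ∧ ∀ i, eval v (pderiv i f) = 0 := by
  obtain ⟨T, hT⟩ := hf.exists_trilinear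
  rw [(hT _).1] at hp hq hu hw
  rw [trilinear_diag, hp, hq] at hu hw
  set B := T q p p + T p q p + T p p q with hBdef
  set Q := T p q q + T q p q + T q q p with hQdef
  have hu' : a * B + b * Q = 0 := by
    apply mul_left_cancel₀ (mul_ne_zero ha hb); linear_combination hu
  have hw' : c * B + d * Q = 0 := by
    apply mul_left_cancel₀ (mul_ne_zero hc hd); linear_combination hw
  have hB : B = 0 := by
    apply mul_left_cancel₀ hne; linear_combination d * hu' - b * hw'
  have hQ : Q = 0 := by
    apply mul_left_cancel₀ hne; linear_combination a * hw' - c * hu'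
  obtain ⟨r, hr⟩ : ∃ r, crossProduct p q ⬝ᵥ r ≠ 0 := by
    by_contra! h
    exact crossProduct_ne_zero_iff_linearIndependent.2 hpq (dotProduct_eq_zero_iff.1 h)
  -- the derivative in the direction `r` is a binary quadratic form on the line
  obtain ⟨s, t, hst, hz⟩ : ∃ s t : K, (s ≠ 0 ∨ t ≠ 0) ∧
      s ^ 2 * (T r p p + T p r p + T p p r) +
      s * t * (T r p q + T r q p + T p r q + T q r p + T p q r + T q p r) +
      t ^ 2 * (T r q q + T q r q + T q q r) = 0 := by
    by_cases h : T r p p + T p r p + T p p r = 0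
    · exact ⟨1, 0, by simp, by simp [h]⟩
    · obtain ⟨s, hs⟩ := IsAlgClosed.exists_root
        (Polynomial.C (T r p p + T p r p + T p p r) * Polynomial.X ^ 2 +
          Polynomial.C (T r p q + T r q p + T p r q + T q r p + T p q r + T q p r) *
            Polynomial.X + Polynomial.C (T r q q + T q r q + T q q r))
        (by rw [Polynomial.degree_quadratic h]; decide)
      refine ⟨s, 1, by simp, ?_⟩
      simp only [Polynomial.IsRoot, Polynomial.eval_add, Polynomial.eval_mul, Polynomial.eval_C,
        Polynomial.eval_pow, Polynomial.eval_X] at hs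
      linear_combination hs
  have hv : s • p + t • q ≠ 0 := fun h ↦ by
    have := LinearIndependent.pair_iff.1 hpq s t h
    tauto
  refine ⟨s • p + t • q, hv, ?_, ?_⟩
  · rw [(hT _).1, trilinear_diag, hp, hq, ← hBdef, ← hQdef, hB, hQ]; ring
  have hdet : (of ![p, q, r]).det ≠ 0 := by
    convert hr using 1
    simp [det_fin_three, crossProduct, dotProduct, Fin.sum_univ_three]
    ring
  have hgrad := (hT (s • p + t • q)).2
  refine congrFun (eq_zero_of_mulVec_eq_zero hdet
    (v := fun i ↦ eval (s • p + t • q) (pderiv i f)) ?_)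
  ext i
  rw [mulVec, dotProduct_comm]
  fin_cases i
  all_goals
    simp only [of_apply, Fin.mk_zero, Fin.mk_one, Fin.reduceFinMk, cons_val, Pi.zero_apply]
    rw [hgrad]
    simp only [map_add, map_smul, LinearMap.add_apply, LinearMap.smul_apply, smul_eq_mul]
  · linear_combination 3 * s ^ 2 * hp + 2 * s * t * hB + t ^ 2 * hQ
  · linear_combination 3 * t ^ 2 * hq + 2 * s * t * hQ + s ^ 2 * hB
  · linear_combination hz

/-- In characteristic two, if `v` is a zero of the cubic form `f` orthogonal to the gradient of
`f` at `p`, then the line `pv` contains three zeros of `f` only if `f` vanishes at `p`. -/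
lemma eval_eq_zero_of_orthogonal_gradient [CharP K 2] {f : MvPolynomial (Fin 3) K}
    (hf : f.IsHomogeneous 3) {p v : Fin 3 → K} {a b c d : K} (ha : a ≠ 0) (hc : c ≠ 0)
    (hne : a * d - b * c ≠ 0) (hgrad : (fun i ↦ eval p (pderiv i f)) ⬝ᵥ v = 0)
    (hv : eval v f = 0) (hu : eval (a • p + b • v) f = 0)
    (hw : eval (c • p + d • v) f = 0) : eval p f = 0 := by
  obtain ⟨T, hT⟩ := hf.exists_trilinear
  rw [(hT _).2] at hgrad
  rw [(hT _).1] at hv hu hw ⊢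
  rw [trilinear_diag, hv, hgrad] at hu hw
  have h2 : (2 : K) = 0 := CharTwo.two_eq_zero
  have hu' : a ^ 2 * T p p p + b ^ 2 * (T p v v + T v p v + T v v p) = 0 := by
    apply mul_left_cancel₀ ha; linear_combination hu
  have hw' : c ^ 2 * T p p p + d ^ 2 * (T p v v + T v p v + T v v p) = 0 := by
    apply mul_left_cancel₀ hc; linear_combination hw
  apply mul_left_cancel₀ (pow_ne_zero 2 hne)
  linear_combination d ^ 2 * hu' - b ^ 2 * hw' +
    (b ^ 2 * c ^ 2 - a * b * c * d) * T p p p * h2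

lemma gradient_dotProduct_self [CharP K 2] {f : MvPolynomial (Fin 3) K}
    (hf : f.IsHomogeneous 3) (p : Fin 3 → K) :
    (fun i ↦ eval p (pderiv i f)) ⬝ᵥ p = eval p f := by
  obtain ⟨T, hT⟩ := hf.exists_trilinear
  rw [(hT p).2, (hT p).1]
  linear_combination T p p p * CharTwo.two_eq_zero (R := K)

end Algebra

section Projective

open Configuration Configuration.ofField Finset Matrix
open scoped Classical LinearAlgebra.Projectivization

lemma mem_iff_rep {F : Type*} [Field F] (P L : ℙ F (Fin 3 → F)) :
    P ∈ L ↔ P.rep ⬝ᵥ L.rep = 0 := by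
  conv_lhs => rw [mem_iff, ← P.mk_rep, ← L.mk_rep, Projectivization.orthogonal_mk]

lemma order_eq_four {F : Type*} [Field F] [Fintype F] (hF : Fintype.card F = 4) :
    ProjectivePlane.order (ℙ F (Fin 3 → F)) (ℙ F (Fin 3 → F)) = 4 := by
  have : Fintype (ℙ F (Fin 3 → F)) := Fintype.ofFinite _
  have h := ProjectivePlane.card_points (ℙ F (Fin 3 → F)) (ℙ F (Fin 3 → F))
  rw [← Nat.card_eq_fintype_card, Projectivization.card_of_finrank F (Fin 3 → F) (n := 3)
    (by simp), Nat.card_eq_fintype_card, hF] at h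
  simp only [sum_range_succ, range_zero, sum_empty] at h
  nlinarith

lemma LinearIndependent.pair_comp_algebraMap {F K : Type*} [Field F] [Field K] [Algebra F K]
    {p q : Fin 3 → F} (h : LinearIndependent F ![p, q]) :
    LinearIndependent K ![algebraMap F K ∘ p, algebraMap F K ∘ q] := by
  rw [← crossProduct_ne_zero_iff_linearIndependent] at h ⊢
  have hcomp : crossProduct (algebraMap F K ∘ p) (algebraMap F K ∘ q) =
      algebraMap F K ∘ crossProduct p q := by
    ext i; fin_cases i <;> simp [cross_apply]
  rw [hcomp]
  contrapose! h
  ext i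
  simpa using congrFun h i

variable {F : Type*} [Field F] {f : MvPolynomial (Fin 3) F}

lemma secantCard_le_three (hf : f.IsHomogeneous 3)
    (hns : ∀ v : Fin 3 → AlgebraicClosure F, v ≠ 0 →
      eval v (map (algebraMap F (AlgebraicClosure F)) f) = 0 →
      ∃ i, eval v (pderiv i (map (algebraMap F (AlgebraicClosure F)) f)) ≠ 0)
    {S : Finset (ℙ F (Fin 3 → F))} (hS : ∀ P ∈ S, eval P.rep f = 0) (L : ℙ F (Fin 3 → F)) :
    secantCard S L ≤ 3 := by
  by_contra! h
  obtain ⟨T, hTS, hT⟩ := exists_subset_card_eq (Nat.succ_le_of_lt h)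
  obtain ⟨P, Q, U, W, hPQ, hPU, hPW, hQU, hQW, hUW, rfl⟩ := card_eq_four.1 hT
  have hmem (X : ℙ F (Fin 3 → F)) (hX : X ∈ ({P, Q, U, W} : Finset (ℙ F (Fin 3 → F)))) :
      eval X.rep f = 0 ∧ X.rep ⬝ᵥ L.rep = 0 := by
    have := mem_filter.1 (hTS hX)
    exact ⟨hS X this.1, (mem_iff_rep X L).1 this.2⟩
  obtain ⟨hP, hPL⟩ := hmem P (by simp)
  obtain ⟨hQ, hQL⟩ := hmem Q (by simp)
  obtain ⟨hU, hUL⟩ := hmem U (by simp)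
  obtain ⟨hW, hWL⟩ := hmem W (by simp)
  have ind {X Y : ℙ F (Fin 3 → F)} (h : X ≠ Y) : LinearIndependent F ![X.rep, Y.rep] :=
    Projectivization.linearIndependent_pair_iff_ne.2 h
  obtain ⟨a, b, ha, hb, hab⟩ := exists_coords (ind hPQ) (ind hPU.symm) (ind hQU.symm)
    L.rep_nonzero hPL hQL hUL
  obtain ⟨c, d, hc, hd, hcd⟩ := exists_coords (ind hPQ) (ind hPW.symm) (ind hQW.symm)
    L.rep_nonzero hPL hQL hWL
  have hne := mul_sub_mul_ne_zero ha (hab ▸ hcd ▸ ind hUW)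
  rw [hab] at hU
  rw [hcd] at hW
  let φ := algebraMap F (AlgebraicClosure F)
  have hφ {v : Fin 3 → F} (hv : eval v f = 0) : eval (φ ∘ v) (map φ f) = 0 := by
    rw [eval_map, ← eval₂_comp, hv, map_zero]
  have hcomb (x y : F) : φ ∘ (x • P.rep + y • Q.rep) =
      φ x • (φ ∘ P.rep) + φ y • (φ ∘ Q.rep) := by
    ext i; simp
  obtain ⟨v, hv, hv0, hsing⟩ := exists_singular_of_four_zeros (hf.map φ)
    (ind hPQ).pair_comp_algebraMap
    ((map_ne_zero φ).2 ha) ((map_ne_zero φ).2 hb) ((map_ne_zero φ).2 hc) ((map_ne_zero φ).2 hd)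
    (by simpa using (map_ne_zero φ).2 hne) (hφ hP) (hφ hQ) (hcomb a b ▸ hφ hU)
    (hcomb c d ▸ hφ hW)
  obtain ⟨i, hi⟩ := hns v hv hv0
  exact hi (hsing i)

/-- The polar line of a point on two lines missing the cubic is a third such line. -/
lemma exists_third_external_line [CharP F 2] (hf : f.IsHomogeneous 3)
    {S : Finset (ℙ F (Fin 3 → F))} (hS : ∀ P, P ∈ S ↔ eval P.rep f = 0)
    {P L M : ℙ F (Fin 3 → F)} (hPL : P ∈ L) (hL : secantCard S L = 0)
    (hM : secantCard S M = 0)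
    (h3 : ∀ K : ℙ F (Fin 3 → F), P ∈ K → K ≠ L → K ≠ M → secantCard S K = 3) :
    ∃ N : ℙ F (Fin 3 → F), P ∉ N ∧ secantCard S N = 0 := by
  have hext {X K : ℙ F (Fin 3 → F)} (hK : secantCard S K = 0) (hX : X ∈ K) : X ∉ S := by
    intro hXS
    exact filter_eq_empty_iff.1 (card_eq_zero.1 hK) hXS hX
  have hP : eval P.rep f ≠ 0 := mt (hS P).2 (hext hL hPL)
  have hself := gradient_dotProduct_self hf P.rep
  set g : Fin 3 → F := fun i ↦ eval P.rep (pderiv i f) with hg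
  have hg0 : g ≠ 0 := by
    intro h
    rw [h, zero_dotProduct] at hself
    exact hP hself.symm
  have hmem (X : ℙ F (Fin 3 → F)) : X ∈ Projectivization.mk F g hg0 ↔ g ⬝ᵥ X.rep = 0 := by
    conv_lhs => rw [mem_iff, ← X.mk_rep, Projectivization.orthogonal_mk, dotProduct_comm]
  refine ⟨Projectivization.mk F g hg0, ?_, ?_⟩
  · rwa [hmem, hself]
  refine card_eq_zero.2 (filter_eq_empty_iff.2 fun V hVS hV ↦ ?_)
  rw [hmem] at hV
  have hVP : V ≠ P := by rintro rfl; exact hP ((hS _).1 hVS)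
  obtain ⟨K, ⟨hPK, hVK⟩, -⟩ := HasLines.existsUnique_line
    (ℙ F (Fin 3 → F)) (ℙ F (Fin 3 → F)) P V hVP.symm
  have hK := h3 K hPK (fun h ↦ hext hL (h ▸ hVK) hVS) (fun h ↦ hext hM (h ▸ hVK) hVS)
  have hK2 : 1 < #(({X ∈ S | X ∈ K} : Finset (ℙ F (Fin 3 → F))).erase V) := by
    rw [card_erase_of_mem (mem_filter.2 ⟨hVS, hVK⟩)]
    change 1 < secantCard S K - 1
    omega
  obtain ⟨U, hU, W, hW, hUW⟩ := one_lt_card.1 hK2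
  simp only [mem_erase, mem_filter] at hU hW
  obtain ⟨hUV, hUS, hUK⟩ := hU
  obtain ⟨hWV, hWS, hWK⟩ := hW
  rw [mem_iff_rep] at hPK hVK hUK hWK
  rw [hS] at hVS hUS hWS
  have ind {X Y : ℙ F (Fin 3 → F)} (h : X ≠ Y) : LinearIndependent F ![X.rep, Y.rep] :=
    Projectivization.linearIndependent_pair_iff_ne.2 h
  obtain ⟨a, b, ha, -, hab⟩ := exists_coords (ind hVP.symm)
    (ind fun h ↦ hP (h ▸ hUS)) (ind hUV) K.rep_nonzero hPK hVK hUK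
  obtain ⟨c, d, hc, -, hcd⟩ := exists_coords (ind hVP.symm)
    (ind fun h ↦ hP (h ▸ hWS)) (ind hWV) K.rep_nonzero hPK hVK hWK
  exact hP (eval_eq_zero_of_orthogonal_gradient hf ha hc
    (mul_sub_mul_ne_zero ha (hab ▸ hcd ▸ ind hUW)) hV hVS (hab ▸ hUS) (hcd ▸ hWS))

end Projective

/-- For a nonsingular plane cubic over `F₄` with exactly nine rational points, the numbers
`μ_δ` of `δ`-lines satisfy `(μ₀,μ₁,μ₂,μ₃) = (0,9,0,12)` or `(3,0,9,9)`. -/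
theorem stmt_15 (f : MvPolynomial (Fin 3) (GaloisField 2 2))
    (hhom : f.IsHomogeneous 3) (hns : IsNonsingularCubic f)
    (h9 : {P : Projectivization (GaloisField 2 2) (Fin 3 → GaloisField 2 2) |
      eval P.rep f = 0}.ncard = 9) :
    (mu f 0 = 0 ∧ mu f 1 = 9 ∧ mu f 2 = 0 ∧ mu f 3 = 12) ∨
    (mu f 0 = 3 ∧ mu f 1 = 0 ∧ mu f 2 = 9 ∧ mu f 3 = 9) := by
  classical
  have : Fintype (Projectivization (GaloisField 2 2) (Fin 3 → GaloisField 2 2)) :=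
    Fintype.ofFinite _
  have : Fintype (GaloisField 2 2) := Fintype.ofFinite _
  have hF : Fintype.card (GaloisField 2 2) = 4 := by
    rw [← Nat.card_eq_fintype_card, GaloisField.card 2 2 two_ne_zero]; norm_num
  set S : Finset (Projectivization (GaloisField 2 2) (Fin 3 → GaloisField 2 2)) :=
    Finset.univ.filter fun P ↦ eval P.rep f = 0 with hS
  have hmemS (P) : P ∈ S ↔ eval P.rep f = 0 := by simp [hS]
  have hcard : S.card = 9 := by
    rw [← h9, ← Set.ncard_coe_finset]; simp [hS]
  have hmu (δ : ℕ) : mu f δ = (Finset.univ.filter fun L :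
      Projectivization (GaloisField 2 2) (Fin 3 → GaloisField 2 2) ↦ secantCard S L = δ).card := by
    rw [mu, ← Set.ncard_coe_finset]
    congr 1
    ext L
    rw [Finset.coe_filter_univ, Set.mem_ofPred_eq, Set.mem_ofPred_eq, secantCard,
      ← Set.ncard_coe_finset]
    simp [hS, mem_iff_rep, dotProduct, Fin.sum_univ_three, mul_comm, and_comm]
  simp only [hmu]
  exact line_counts_of_exists_third (order_eq_four hF) hcard
    (secantCard_le_three hhom hns fun P ↦ (hmemS P).1)
    fun P L M _ hPL _ hL hM h3 ↦ exists_third_external_line hhom hmemS hPL hL hM h3
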